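/- arXiv:2312.03057 — 5 statements merged into one kernel-verified Lean document; each statement's English description precedes it below -/
import Mathlib

section
/- Let D ≥ 1 and M ≥ 0 be natural numbers, and let p be an arbitrary probability distribution on the finite vector space 𝔽₂^D. If y₁, …, y_M, y are M + 1 random vectors drawn independently from p (IID), then the probability that y can be written as an 𝔽₂-linear combination of y₁, …, y_M, i.e. P[∃ α₁,…,α_M ∈ 𝔽₂, y = Σ_{m=1}^M α_m y_m] = P[y ∈ span{y₁,…,y_M}], is at least 1 − D/(M+1). -/
open Finset

/-- At most `finrank K V` members of a finite family lie outside the span of the others. -/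
theorem card_filter_notMem_span_image_compl_le_finrank {K V ι : Type*} [Field K]
    [AddCommGroup V] [Module K V] [FiniteDimensional K V] [Fintype ι] (v : ι → V)
    [DecidablePred fun i => v i ∉ Submodule.span K (v '' {i}ᶜ)] :
    #{i | v i ∉ Submodule.span K (v '' {i}ᶜ)} ≤ Module.finrank K V := by
  have hli : LinearIndependent K
      fun i : {i // i ∈ ({i | v i ∉ Submodule.span K (v '' {i}ᶜ)} : Finset ι)} => v i := by
    rw [linearIndependent_iff_notMem_span]
    rintro ⟨i, hi⟩ h
    refine (Finset.mem_filter.mp hi).2 (Submodule.span_mono ?_ h)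
    rintro _ ⟨⟨j, hj⟩, hji, rfl⟩
    exact ⟨j, fun h => hji.2 (Subtype.ext h), rfl⟩
  exact (Fintype.card_coe _).symm.trans_le hli.fintype_card_le_finrank

/-- In an IID family, each member is equally likely to lie outside the span of the others. -/
theorem sum_prod_mul_notMem_span_image_compl_eq {K V R ι : Type*} [Semiring K]
    [AddCommMonoid V] [Module K V] [Fintype V] [CommSemiring R] [Fintype ι] [DecidableEq ι]
    (p : V → R) (i j : ι)
    [∀ (y : ι → V) (k : ι), Decidable (y k ∉ Submodule.span K (y '' {k}ᶜ))] :
    ∑ y : ι → V, (∏ k, p (y k)) *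
        (if y i ∉ Submodule.span K (y '' {i}ᶜ) then (1 : R) else 0) =
      ∑ y : ι → V, (∏ k, p (y k)) *
        (if y j ∉ Submodule.span K (y '' {j}ᶜ) then (1 : R) else 0) := by
  refine Fintype.sum_equiv ((Equiv.swap i j).arrowCongr (Equiv.refl V)) _ _ fun y => ?_
  have hy : (Equiv.swap i j).arrowCongr (Equiv.refl V) y = y ∘ Equiv.swap i j := by
    ext; simp
  have himage : (y ∘ Equiv.swap i j) '' {j}ᶜ = y '' {i}ᶜ := by
    rw [Set.image_comp, Set.image_compl_eq (Equiv.swap i j).bijective]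
    simp
  rw [hy]
  congr 1
  · exact (Equiv.prod_comp (Equiv.swap i j) fun k => p (y k)).symm
  · refine if_congr ?_ rfl rfl
    rw [himage, Function.comp_apply, Equiv.swap_apply_right]

/- STATEMENT 0: For any probability mass function `p` on `𝔽₂^D` and `M + 1` IID draws
`y 0, …, y (M-1), y (last M)` from `p`, the probability that the last vector lies in the
`𝔽₂`-linear span of the first `M` vectors is at least `1 - D / (M + 1)`. -/
open Classical in
theorem iid_last_in_span_prob_ge (D M : ℕ) (hD : 1 ≤ D)
    (p : (Fin D → ZMod 2) → ℝ) (hp : ∀ v, 0 ≤ p v) (hp1 : ∑ v, p v = 1) :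
    (1 : ℝ) - (D : ℝ) / ((M : ℝ) + 1) ≤
      ∑ y : Fin (M + 1) → (Fin D → ZMod 2),
        (∏ i, p (y i)) *
          (if y (Fin.last M) ∈ Submodule.span (ZMod 2)
              (Set.range fun m : Fin M => y m.castSucc) then (1 : ℝ) else 0) := by
  have hrange (y : Fin (M + 1) → Fin D → ZMod 2) :
      (Set.range fun m : Fin M => y m.castSucc) = y '' {Fin.last M}ᶜ := by
    rw [← Fin.range_succAbove, ← Set.range_comp]
    simp [Function.comp_def]
  have htotal : ∑ y : Fin (M + 1) → Fin D → ZMod 2, ∏ i, p (y i) = 1 := by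
    simp [← Fintype.prod_sum fun _ => p, hp1]
  let q (i : Fin (M + 1)) : ℝ := ∑ y : Fin (M + 1) → Fin D → ZMod 2, (∏ k, p (y k)) *
    (if y i ∉ Submodule.span (ZMod 2) (y '' {i}ᶜ) then 1 else 0)
  have hsum : ∑ i, q i ≤ D := by
    calc ∑ i, q i
        = ∑ y : Fin (M + 1) → Fin D → ZMod 2, (∏ k, p (y k)) *
            (#{i | y i ∉ Submodule.span (ZMod 2) (y '' {i}ᶜ)} : ℝ) := by
          simp only [q]
          rw [Finset.sum_comm]
          simp only [← Finset.mul_sum, Finset.sum_boole]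
      _ ≤ ∑ y : Fin (M + 1) → Fin D → ZMod 2, (∏ k, p (y k)) * (D : ℝ) := by
          gcongr with y
          · exact Finset.prod_nonneg fun k _ => hp _
          · simpa using card_filter_notMem_span_image_compl_le_finrank (K := ZMod 2) y
      _ = D := by rw [← Finset.sum_mul, htotal, one_mul]
  have hq : ((M : ℝ) + 1) * q (Fin.last M) ≤ D := by
    have hconst : ∑ i, q i = ∑ _i : Fin (M + 1), q (Fin.last M) :=
      Finset.sum_congr rfl fun i _ => sum_prod_mul_notMem_span_image_compl_eq p i _
    simpa [hconst] using hsum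
  have hcompl : ∑ y : Fin (M + 1) → Fin D → ZMod 2, (∏ i, p (y i)) *
      (if y (Fin.last M) ∈ Submodule.span (ZMod 2)
        (Set.range fun m : Fin M => y m.castSucc) then (1 : ℝ) else 0) =
      1 - q (Fin.last M) := by
    rw [← htotal, ← Finset.sum_sub_distrib]
    refine Finset.sum_congr rfl fun y _ => ?_
    rw [hrange]
    split_ifs <;> simp_all
  rw [hcompl]
  gcongr
  rw [le_div_iff₀' (by positivity)]
  exact hq
end

section
/- Let D ≥ 1 and M ≥ 0 be natural numbers, let p be an arbitrary probability distribution on 𝔽₂^D, and let y₁, …, y_{M+1} be IID random vectors with distribution p. For a realization (y₁,…,y_{M+1}) let B = { i ∈ {1,…,M+1} : y_i ∉ span{y_j : j ≠ i} } be the (random) set of indices whose vector is not an 𝔽₂-linear combination of the others. Then P[ y_{M+1} ∉ span{y₁,…,y_M} ] = E[|B|] / (M+1). -/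
open Finset

/-- A product-weighted count of the families in which the `i`-th vector avoids the span of the
others does not depend on the index `i`. -/
theorem sum_prod_mul_notMem_span_eq {ι K V R : Type*} [Fintype ι] [DecidableEq ι] [Fintype V]
    [Semiring K] [AddCommMonoid V] [Module K V] [CommSemiring R] (p : V → R)
    [∀ (i : ι) (y : ι → V), Decidable (y i ∉ Submodule.span K (y '' {j | j ≠ i}))] (i k : ι) :
    (∑ y : ι → V, (∏ j, p (y j)) *
        (if y i ∉ Submodule.span K (y '' {j | j ≠ i}) then 1 else 0)) =
      ∑ y : ι → V, (∏ j, p (y j)) *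
        (if y k ∉ Submodule.span K (y '' {j | j ≠ k}) then 1 else 0) := by
  refine Fintype.sum_equiv ((Equiv.swap i k).arrowCongr (Equiv.refl V)) _ _ fun y => ?_
  have himage : (y ∘ Equiv.swap i k) '' {j | j ≠ k} = y '' {j | j ≠ i} := by
    rw [Set.image_comp, Equiv.image_eq_preimage_symm]
    congr 1
    ext j
    simp [Equiv.swap_apply_eq_iff]
  have hcomp : (Equiv.swap i k).arrowCongr (Equiv.refl V) y = y ∘ Equiv.swap i k := rfl
  have hprod : ∏ j, p (y (Equiv.swap i k j)) = ∏ j, p (y j) :=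
    Equiv.prod_comp (Equiv.swap i k) fun j => p (y j)
  have hmem : y i ∉ Submodule.span K (y '' {j | j ≠ i}) ↔
      (Equiv.swap i k).arrowCongr (Equiv.refl V) y k ∉
        Submodule.span K ((Equiv.swap i k).arrowCongr (Equiv.refl V) y '' {j | j ≠ k}) := by
    rw [hcomp, himage, Function.comp_apply, Equiv.swap_apply_right]
  rw [if_congr hmem rfl rfl]
  simp only [hcomp, Function.comp_apply, hprod]

theorem Fin.image_ne_last_eq_range_castSucc {α : Type*} {M : ℕ} (y : Fin (M + 1) → α) :
    y '' {j | j ≠ Fin.last M} = Set.range fun m : Fin M => y m.castSucc := by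
  have h : {j | j ≠ Fin.last M} = Set.range (Fin.castSucc : Fin M → Fin (M + 1)) := by
    rw [Fin.range_castSucc]
    ext j
    exact Fin.lt_last_iff_ne_last.symm
  rw [h, ← Set.range_comp]
  rfl

/- STATEMENT 3: For `M + 1` IID draws from a pmf `p` on `𝔽₂^D`, the probability that the
last vector is NOT in the span of the first `M` equals the expected cardinality of the set
`B` of indices whose vector is not a linear combination of the others, divided by `M + 1`. -/
open Classical in
theorem prob_last_not_in_span_eq_expected_card_div (D M : ℕ) (hD : 1 ≤ D)
    (p : (Fin D → ZMod 2) → ℝ) (hp : ∀ v, 0 ≤ p v) (hp1 : ∑ v, p v = 1) :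
    (∑ y : Fin (M + 1) → (Fin D → ZMod 2),
        (∏ i, p (y i)) *
          (if y (Fin.last M) ∉ Submodule.span (ZMod 2)
              (Set.range fun m : Fin M => y m.castSucc) then (1 : ℝ) else 0))
      =
      (∑ y : Fin (M + 1) → (Fin D → ZMod 2),
        (∏ i, p (y i)) *
          ((Finset.univ.filter fun i : Fin (M + 1) =>
              y i ∉ Submodule.span (ZMod 2) (y '' {j | j ≠ i})).card : ℝ))
      / ((M : ℝ) + 1) := by
  rw [eq_div_iff (by positivity)]
  simp only [card_filter, Nat.cast_sum, Nat.cast_ite, Nat.cast_one, Nat.cast_zero, mul_sum]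
  rw [sum_comm, sum_congr rfl fun i _ =>
    sum_prod_mul_notMem_span_eq (K := ZMod 2) p i (Fin.last M)]
  simp only [Fin.image_ne_last_eq_range_castSucc, sum_const, card_univ, Fintype.card_fin,
    nsmul_eq_mul, Nat.cast_add, Nat.cast_one]
  ring
end

section
/- Let D ≥ 1 and M ≥ 0 be natural numbers, let p be an arbitrary probability distribution on 𝔽₂^D, and let y₁, …, y_{M+1} be IID random vectors with distribution p. For a realization let B = { i ∈ {1,…,M+1} : y_i ∉ span{y_j : j ≠ i} }. For every m′ ∈ {0,1,…,D} such that the event {|B| = m′} has positive probability, the conditional probability that the last index is in B, namely P[ M+1 ∈ B ∣ |B| = m′ ], equals m′/(M+1). -/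
open Finset

section Exchangeable

variable {ι α : Type*} [Fintype ι]

/-- Permuting the indices does not change the number of indices satisfying an equivariant
predicate. -/
lemma card_filter_comp_perm (Q : (ι → α) → ι → Prop) [∀ y, DecidablePred (Q y)]
    (hQ : ∀ (σ : Equiv.Perm ι) y i, Q (y ∘ σ) i ↔ Q y (σ i)) (σ : Equiv.Perm ι) (y : ι → α) :
    (univ.filter (Q (y ∘ σ))).card = (univ.filter (Q y)).card :=
  Finset.card_equiv σ fun i => by simp [hQ]

variable [DecidableEq ι] [Fintype α]

/-- For an exchangeable weight, all indices contribute equally to the weight of the event that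
an index satisfies an equivariant predicate which holds at exactly `m` indices. -/
lemma sum_mul_ite_and_card_eq (w : (ι → α) → ℝ) (Q : (ι → α) → ι → Prop)
    [∀ y, DecidablePred (Q y)] (hw : ∀ (σ : Equiv.Perm ι) y, w (y ∘ σ) = w y)
    (hQ : ∀ (σ : Equiv.Perm ι) y i, Q (y ∘ σ) i ↔ Q y (σ i)) (m : ℕ) (a b : ι) :
    ∑ y, w y * (if Q y a ∧ (univ.filter (Q y)).card = m then (1 : ℝ) else 0) =
      ∑ y, w y * (if Q y b ∧ (univ.filter (Q y)).card = m then (1 : ℝ) else 0) := by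
  refine Fintype.sum_equiv (Equiv.arrowCongr (Equiv.swap a b) (Equiv.refl α)) _ _ fun y => ?_
  have h : Equiv.arrowCongr (Equiv.swap a b) (Equiv.refl α) y = y ∘ Equiv.swap a b := by
    ext i
    simp [Equiv.arrowCongr]
  rw [h, hw, card_filter_comp_perm Q hQ]
  simp only [hQ, Equiv.swap_apply_right]

/-- Double counting: for an exchangeable weight and an equivariant predicate `Q` on indices, the
weight of `Q` holding at `a` and at exactly `m` indices is `m / |ι|` times the weight of `Q`
holding at exactly `m` indices. -/
lemma card_mul_sum_mul_ite_and_card (w : (ι → α) → ℝ) (Q : (ι → α) → ι → Prop)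
    [∀ y, DecidablePred (Q y)] (hw : ∀ (σ : Equiv.Perm ι) y, w (y ∘ σ) = w y)
    (hQ : ∀ (σ : Equiv.Perm ι) y i, Q (y ∘ σ) i ↔ Q y (σ i)) (m : ℕ) (a : ι) :
    (Fintype.card ι : ℝ) *
        ∑ y, w y * (if Q y a ∧ (univ.filter (Q y)).card = m then (1 : ℝ) else 0) =
      m * ∑ y, w y * (if (univ.filter (Q y)).card = m then (1 : ℝ) else 0) := by
  calc _ = ∑ b : ι, ∑ y, w y *
          (if Q y b ∧ (univ.filter (Q y)).card = m then (1 : ℝ) else 0) := by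
        rw [Finset.sum_congr rfl fun b _ => sum_mul_ite_and_card_eq w Q hw hQ m b a]
        simp
    _ = _ := by
        rw [Finset.sum_comm, Finset.mul_sum]
        refine Finset.sum_congr rfl fun y _ => ?_
        rw [← Finset.mul_sum]
        by_cases h : (univ.filter (Q y)).card = m
        · simp [h, mul_comm]
        · simp [h]

end Exchangeable

/-- Not being in the span of the other members of a family is equivariant under reindexing. -/
lemma comp_perm_notMem_span_image_ne {ι R V : Type*} [Semiring R] [AddCommMonoid V] [Module R V]
    (σ : Equiv.Perm ι) (y : ι → V) (i : ι) :
    (y ∘ σ) i ∉ Submodule.span R ((y ∘ σ) '' {j | j ≠ i}) ↔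
      y (σ i) ∉ Submodule.span R (y '' {j | j ≠ σ i}) := by
  have h : σ '' {j | j ≠ i} = {j | j ≠ σ i} := by
    ext j
    simp [Equiv.image_eq_preimage_symm, Equiv.symm_apply_eq]
  rw [Set.image_comp, h, Function.comp_apply]

/- STATEMENT 4: For `M + 1` IID draws from a pmf `p` on `𝔽₂^D` and any `m' ≤ D` such that
the event `|B| = m'` has positive probability (where `B` is the set of indices whose vector
is not a linear combination of the others), the conditional probability that the last index
lies in `B` given `|B| = m'` equals `m' / (M + 1)`. -/
open Classical in
theorem condProb_last_in_B_given_card (D M m' : ℕ) (hD : 1 ≤ D) (hm' : m' ≤ D)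
    (p : (Fin D → ZMod 2) → ℝ) (hp : ∀ v, 0 ≤ p v) (hp1 : ∑ v, p v = 1)
    (hpos : 0 <
      ∑ y : Fin (M + 1) → (Fin D → ZMod 2),
        (∏ i, p (y i)) *
          (if (Finset.univ.filter fun i : Fin (M + 1) =>
              y i ∉ Submodule.span (ZMod 2) (y '' {j | j ≠ i})).card = m'
            then (1 : ℝ) else 0)) :
    (∑ y : Fin (M + 1) → (Fin D → ZMod 2),
        (∏ i, p (y i)) *
          (if (y (Fin.last M) ∉ Submodule.span (ZMod 2)
                (y '' {j | j ≠ Fin.last M})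
              ∧ (Finset.univ.filter fun i : Fin (M + 1) =>
                  y i ∉ Submodule.span (ZMod 2) (y '' {j | j ≠ i})).card = m')
            then (1 : ℝ) else 0))
      /
      (∑ y : Fin (M + 1) → (Fin D → ZMod 2),
        (∏ i, p (y i)) *
          (if (Finset.univ.filter fun i : Fin (M + 1) =>
              y i ∉ Submodule.span (ZMod 2) (y '' {j | j ≠ i})).card = m'
            then (1 : ℝ) else 0))
      = (m' : ℝ) / ((M : ℝ) + 1) := by
  have h := card_mul_sum_mul_ite_and_card (fun y : Fin (M + 1) → (Fin D → ZMod 2) => ∏ i, p (y i))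
    (fun y i => y i ∉ Submodule.span (ZMod 2) (y '' {j | j ≠ i}))
    (fun σ y => Equiv.prod_comp σ fun i => p (y i))
    comp_perm_notMem_span_image_ne m' (Fin.last M)
  rw [Fintype.card_fin, Nat.cast_add, Nat.cast_one] at h
  rw [div_eq_div_iff hpos.ne' (by positivity), mul_comm]
  exact h
end

section
/- Let X be a nonempty finite set, 𝒟 a probability distribution on X, D ≥ 1 a natural number, f : X → 𝔽₂^D any function, and 0 < ε < 1. Set M = ⌈D/ε − 1⌉ (the smallest integer ≥ D/ε − 1). If x, x₁, …, x_M are M + 1 IID samples from 𝒟, then the probability that the feature of the fresh input lies in the span of the sample features, P[ f(x) ∈ span{f(x₁),…,f(x_M)} ], is at least 1 − ε. -/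
open Finset

/-- At most `finrank K V` members of a finite family lie outside the span of the others. -/
theorem card_filter_notMem_span_others_le_finrank {K V ι : Type*} [DivisionRing K]
    [AddCommGroup V] [Module K V] [FiniteDimensional K V] [Fintype ι] (v : ι → V)
    [DecidablePred fun i => v i ∉ Submodule.span K (v '' {i}ᶜ)] :
    #{i | v i ∉ Submodule.span K (v '' {i}ᶜ)} ≤ Module.finrank K V := by
  let s : Finset ι := {i | v i ∉ Submodule.span K (v '' {i}ᶜ)}
  have hli : LinearIndependent K fun i : s => v i := by
    rw [linearIndependent_iff_notMem_span]
    intro i hi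
    refine (mem_filter.mp i.2).2 (Submodule.span_mono ?_ hi)
    rintro _ ⟨j, hj, rfl⟩
    exact ⟨j, fun h => hj.2 (Subtype.ext h), rfl⟩
  exact (Fintype.card_coe s).symm.trans_le hli.fintype_card_le_finrank

/-- Under a product weight, the total weight of the families whose `i`-th member lies outside the
span of the others does not depend on `i`. -/
theorem sum_prod_mul_notMem_span_others_eq {K V X ι : Type*} [DivisionRing K]
    [AddCommGroup V] [Module K V] [Fintype ι] [DecidableEq ι] [Fintype X] (p : X → ℝ) (f : X → V)
    [∀ i (x : ι → X), Decidable (f (x i) ∉ Submodule.span K ((f ∘ x) '' {i}ᶜ))] (i j : ι) :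
    ∑ x : ι → X, (∏ k, p (x k)) *
        (if f (x i) ∉ Submodule.span K ((f ∘ x) '' {i}ᶜ) then (1 : ℝ) else 0) =
      ∑ x : ι → X, (∏ k, p (x k)) *
        (if f (x j) ∉ Submodule.span K ((f ∘ x) '' {j}ᶜ) then (1 : ℝ) else 0) := by
  refine Fintype.sum_equiv ((Equiv.swap i j).arrowCongr (Equiv.refl X)) _ _ fun x => ?_
  have himage : (f ∘ (x ∘ Equiv.swap i j)) '' {j}ᶜ = (f ∘ x) '' {i}ᶜ := by
    rw [← Function.comp_assoc, Set.image_comp, Set.image_compl_eq (Equiv.bijective _),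
      Set.image_singleton, Equiv.swap_apply_right]
  have hx : (Equiv.swap i j).arrowCongr (Equiv.refl X) x = x ∘ Equiv.swap i j := by
    ext; simp [Equiv.arrowCongr]
  rw [hx]
  congr 1
  · exact (Equiv.prod_comp (Equiv.swap i j) fun k => p (x k)).symm
  · refine if_congr ?_ rfl rfl
    rw [himage, Function.comp_apply, Equiv.swap_apply_right]

/-- Among independent samples, a given one has its feature outside the span of the other features
with probability at most the dimension divided by the number of samples. -/
theorem card_mul_sum_prod_mul_notMem_span_others_le {K V X ι : Type*} [DivisionRing K]
    [AddCommGroup V] [Module K V] [FiniteDimensional K V] [Fintype ι] [DecidableEq ι] [Fintype X]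
    (p : X → ℝ) (hp : ∀ x, 0 ≤ p x) (hp1 : ∑ x, p x = 1) (f : X → V)
    [∀ i (x : ι → X), Decidable (f (x i) ∉ Submodule.span K ((f ∘ x) '' {i}ᶜ))] (i : ι) :
    Fintype.card ι * ∑ x : ι → X, (∏ k, p (x k)) *
        (if f (x i) ∉ Submodule.span K ((f ∘ x) '' {i}ᶜ) then (1 : ℝ) else 0) ≤
      Module.finrank K V := by
  calc
    _ = ∑ j : ι, ∑ x : ι → X, (∏ k, p (x k)) *
          (if f (x j) ∉ Submodule.span K ((f ∘ x) '' {j}ᶜ) then (1 : ℝ) else 0) := by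
      rw [sum_congr rfl fun j _ => sum_prod_mul_notMem_span_others_eq (K := K) p f j i]
      simp
    _ = ∑ x : ι → X, (∏ k, p (x k)) *
          (#{j | f (x j) ∉ Submodule.span K ((f ∘ x) '' {j}ᶜ)} : ℝ) := by
      rw [sum_comm]
      simp_rw [← mul_sum, sum_boole]
    _ ≤ ∑ x : ι → X, (∏ k, p (x k)) * (Module.finrank K V : ℝ) := by
      refine sum_le_sum fun x _ => mul_le_mul_of_nonneg_left ?_ (prod_nonneg fun k _ => hp _)
      let : DecidablePred fun i => (f ∘ x) i ∉ Submodule.span K ((f ∘ x) '' {i}ᶜ) :=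
        inferInstanceAs (DecidablePred fun i => f (x i) ∉ Submodule.span K ((f ∘ x) '' {i}ᶜ))
      exact_mod_cast card_filter_notMem_span_others_le_finrank (K := K) (f ∘ x)
    _ = Module.finrank K V := by
      rw [← sum_mul, ← Fintype.prod_sum]
      simp [hp1]

/- STATEMENT 5: For a finite input space `X` with pmf `p`, any feature map
`f : X → 𝔽₂^D`, `0 < ε < 1`, and `M = ⌈D/ε − 1⌉` IID samples plus one fresh IID input,
the probability that the feature of the fresh input lies in the span of the sample
features is at least `1 − ε`. -/
open Classical in
theorem fresh_feature_in_span_prob_ge (X : Type) [Fintype X] [Nonempty X]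
    (p : X → ℝ) (hp : ∀ x, 0 ≤ p x) (hp1 : ∑ x, p x = 1)
    (D : ℕ) (hD : 1 ≤ D) (f : X → Fin D → ZMod 2)
    (ε : ℝ) (hε0 : 0 < ε) (hε1 : ε < 1)
    (M : ℕ) (hM : M = ⌈(D : ℝ) / ε - 1⌉₊) :
    (1 : ℝ) - ε ≤
      ∑ x : Fin (M + 1) → X,
        (∏ i, p (x i)) *
          (if f (x (Fin.last M)) ∈ Submodule.span (ZMod 2)
              (Set.range fun m : Fin M => f (x m.castSucc)) then (1 : ℝ) else 0) := by
  have hrange (x : Fin (M + 1) → X) :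
      (Set.range fun m : Fin M => f (x m.castSucc)) = (f ∘ x) '' {Fin.last M}ᶜ := by
    rw [← Fin.range_succAbove, ← Set.range_comp, Fin.succAbove_last]
    rfl
  simp_rw [hrange]
  have hbad := card_mul_sum_prod_mul_notMem_span_others_le (K := ZMod 2) p hp hp1 f (Fin.last M)
  have htotal : ∑ x : Fin (M + 1) → X, ∏ i, p (x i) = 1 := by
    rw [← Fintype.prod_sum]
    simp [hp1]
  have hsplit (x : Fin (M + 1) → X) :
      (if f (x (Fin.last M)) ∈ Submodule.span (ZMod 2) ((f ∘ x) '' {Fin.last M}ᶜ)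
        then (1 : ℝ) else 0) =
      1 - if f (x (Fin.last M)) ∉ Submodule.span (ZMod 2) ((f ∘ x) '' {Fin.last M}ᶜ)
        then (1 : ℝ) else 0 := by
    split_ifs <;> simp
  simp_rw [hsplit, mul_sub, mul_one, sum_sub_distrib, htotal]
  rw [Fintype.card_fin, Module.finrank_fin_fun] at hbad
  have hDM : (D : ℝ) ≤ (M + 1 : ℕ) * ε := by
    have hceil := Nat.le_ceil ((D : ℝ) / ε - 1)
    rw [← hM] at hceil
    rw [← div_le_iff₀ hε0]
    push_cast
    linarith
  have hle := le_of_mul_le_mul_left (hbad.trans hDM) (by positivity)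
  linarith
end

section
/- Let X be a nonempty finite set, 𝒟 a probability distribution on X, D ≥ 1 a natural number, f : X → 𝔽₂^D any function, s ∈ 𝔽₂^D, and M a natural number with M + 1 ≥ D/ε for some 0 < ε < 1. Let T : X^M → 𝔽₂^D be any map such that for every tuple (x₁,…,x_M) ∈ X^M, the output s̃ = T(x₁,…,x_M) satisfies f(x_m) · s̃ = f(x_m) · s for all m ∈ {1,…,M} (such an s̃ always exists, e.g. s̃ = s). Then, for (x₁,…,x_M,x) drawn IID from 𝒟, the probability that the learned hypothesis mispredicts the target concept on the fresh input, P[ f(x) · T(x₁,…,x_M) ≠ f(x) · s ], is at most D/(M+1) ≤ ε. -/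
open Finset

section SpanAvoidance

variable {ι K V : Type*} [Field K] [AddCommGroup V] [Module K V]

open Classical in
/-- In a finite family of vectors, at most `finrank K V` members lie outside the span of the
other ones. -/
lemma card_notMem_span_compl_le_finrank [Fintype ι] [FiniteDimensional K V] (v : ι → V) :
    #{i | v i ∉ Submodule.span K (v '' {i}ᶜ)} ≤ Module.finrank K V := by
  have h : LinearIndependent K
      (fun i : {i // i ∈ ({i | v i ∉ Submodule.span K (v '' {i}ᶜ)} : Finset ι)} => v i) := by
    rw [linearIndependent_iff_notMem_span]
    rintro ⟨i, hi⟩ hmem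
    refine (mem_filter.mp hi).2 (Submodule.span_mono ?_ hmem)
    rintro _ ⟨j, hj, rfl⟩
    exact ⟨j, fun hji => hj.2 (Subtype.ext hji), rfl⟩
  simpa only [Fintype.card_coe] using h.fintype_card_le_finrank

lemma image_comp_perm_compl_singleton {α : Type*} (v : ι → α) (σ : Equiv.Perm ι) (i : ι) :
    (v ∘ σ) '' {i}ᶜ = v '' {σ i}ᶜ := by
  rw [Set.image_comp, Set.image_compl_eq σ.bijective, Set.image_singleton]

open Classical in
/-- Exchangeability: for an IID sample, the probability that the feature vector of the `i`-th
point avoids the span of the others is at most the dimension divided by the sample size. -/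
lemma card_mul_sum_notMem_span_le [Fintype ι] [DecidableEq ι] [FiniteDimensional K V]
    {X : Type*} [Fintype X] (p : X → ℝ) (hp : ∀ x, 0 ≤ p x) (hp1 : ∑ x, p x = 1)
    (f : X → V) (i : ι) :
    (Fintype.card ι : ℝ) * ∑ x : ι → X, (∏ j, p (x j)) *
        (if f (x i) ∉ Submodule.span K ((f ∘ x) '' {i}ᶜ) then (1 : ℝ) else 0)
      ≤ Module.finrank K V := by
  have hsymm (k : ι) : ∑ x : ι → X, (∏ j, p (x j)) *
        (if f (x k) ∉ Submodule.span K ((f ∘ x) '' {k}ᶜ) then (1 : ℝ) else 0)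
      = ∑ x : ι → X, (∏ j, p (x j)) *
        (if f (x i) ∉ Submodule.span K ((f ∘ x) '' {i}ᶜ) then (1 : ℝ) else 0) := by
    rw [← Equiv.sum_comp ((Equiv.swap i k).arrowCongr (Equiv.refl X))]
    refine sum_congr rfl fun x _ => ?_
    have hx : (Equiv.swap i k).arrowCongr (Equiv.refl X) x = x ∘ Equiv.swap i k := by
      ext j; simp
    rw [hx, ← Function.comp_assoc, image_comp_perm_compl_singleton]
    simp only [Function.comp_apply, Equiv.swap_apply_right]
    rw [Equiv.prod_comp (Equiv.swap i k) (fun j => p (x j))]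
  calc _ = ∑ k : ι, ∑ x : ι → X, (∏ j, p (x j)) *
        (if f (x k) ∉ Submodule.span K ((f ∘ x) '' {k}ᶜ) then (1 : ℝ) else 0) := by
        simp only [hsymm, sum_const, card_univ, nsmul_eq_mul]
    _ = ∑ x : ι → X, (∏ j, p (x j)) *
        (#{k | (f ∘ x) k ∉ Submodule.span K ((f ∘ x) '' {k}ᶜ)} : ℝ) := by
        rw [sum_comm]
        refine sum_congr rfl fun x _ => ?_
        rw [← mul_sum, sum_boole]
        rfl
    _ ≤ ∑ x : ι → X, (∏ j, p (x j)) * (Module.finrank K V : ℝ) := by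
        refine sum_le_sum fun x _ => mul_le_mul_of_nonneg_left ?_ (prod_nonneg fun j _ => hp _)
        exact_mod_cast card_notMem_span_compl_le_finrank (f ∘ x)
    _ = Module.finrank K V := by
        rw [← sum_mul, ← Fintype.prod_sum (fun (_ : ι) (x : X) => p x)]
        simp [hp1]

end SpanAvoidance

/-- Two dot products agreeing on a set agree on its span. -/
lemma sum_mul_eq_of_mem_span {ι K : Type*} [Fintype ι] [CommSemiring K] {S : Set (ι → K)}
    {a b v : ι → K} (h : ∀ w ∈ S, ∑ d, w d * a d = ∑ d, w d * b d)
    (hv : v ∈ Submodule.span K S) : ∑ d, v d * a d = ∑ d, v d * b d := by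
  have := LinearMap.eqOn_span (f := Fintype.linearCombination K a)
    (g := Fintype.linearCombination K b) (s := S)
    (fun w hw => by simpa [Fintype.linearCombination_apply] using h w hw) hv
  simpa [Fintype.linearCombination_apply] using this

/- STATEMENT 7: For a finite input space `X` with pmf `p`, a feature map `f : X → 𝔽₂^D`,
a target parameter `s`, `0 < ε < 1`, `M + 1 ≥ D/ε` samples, and any learner `T` that from
the `M` samples outputs `s̃` consistent with the labels `f(xₘ)·s`, the probability (over
`M + 1` IID draws) that the learned hypothesis mispredicts the target concept on the fresh
input is at most `D/(M+1) ≤ ε`. -/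
open Classical in
theorem learned_hypothesis_error_le (X : Type) [Fintype X] [Nonempty X]
    (p : X → ℝ) (hp : ∀ x, 0 ≤ p x) (hp1 : ∑ x, p x = 1)
    (D : ℕ) (hD : 1 ≤ D) (f : X → Fin D → ZMod 2) (s : Fin D → ZMod 2)
    (ε : ℝ) (hε0 : 0 < ε) (hε1 : ε < 1)
    (M : ℕ) (hM : (D : ℝ) / ε ≤ (M : ℝ) + 1)
    (T : (Fin M → X) → Fin D → ZMod 2)
    (hT : ∀ xs : Fin M → X, ∀ m : Fin M,
      ∑ d, f (xs m) d * T xs d = ∑ d, f (xs m) d * s d) :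
    (∑ x : Fin (M + 1) → X,
        (∏ i, p (x i)) *
          (if (∑ d, f (x (Fin.last M)) d * T (fun m => x m.castSucc) d)
              ≠ (∑ d, f (x (Fin.last M)) d * s d) then (1 : ℝ) else 0))
      ≤ (D : ℝ) / ((M : ℝ) + 1)
    ∧ (D : ℝ) / ((M : ℝ) + 1) ≤ ε := by
  have hM0 : (0 : ℝ) < (M : ℝ) + 1 := by positivity
  refine ⟨?_, by rwa [div_le_iff₀ hM0, ← div_le_iff₀' hε0]⟩
  rw [le_div_iff₀' hM0]
  have key := card_mul_sum_notMem_span_le (K := ZMod 2) p hp hp1 f (Fin.last M)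
  simp only [Fintype.card_fin, Module.finrank_fin_fun, Nat.cast_add, Nat.cast_one] at key
  refine le_trans (mul_le_mul_of_nonneg_left (sum_le_sum fun x _ =>
    mul_le_mul_of_nonneg_left ?_ (prod_nonneg fun j _ => hp _)) hM0.le) key
  have himp : f (x (Fin.last M)) ∈ Submodule.span (ZMod 2) ((f ∘ x) '' {Fin.last M}ᶜ) →
      ∑ d, f (x (Fin.last M)) d * T (fun m => x m.castSucc) d
        = ∑ d, f (x (Fin.last M)) d * s d := by
    refine sum_mul_eq_of_mem_span ?_
    rintro _ ⟨j, hj, rfl⟩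
    obtain ⟨m, rfl⟩ := Fin.exists_castSucc_eq.mpr hj
    exact hT (fun m => x m.castSucc) m
  split_ifs with h₁ h₂ <;> first | exact absurd (himp h₂) h₁ | norm_num
end
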